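/- arXiv:1605.05571 — 5 statements merged into one kernel-verified Lean document; each statement's English description precedes it below -/
import Mathlib

section
/- Let ℓ ≤ m ≤ n be positive integers. For a subgroup G of S_ℓ write gComp_m(G) for the subgroup of S_m generated by Comp_m(G), and for a subgroup H of S_n write gPat_ℓ(H) for the subgroup of S_ℓ generated by Pat_ℓ(H). Then for all subgroups G ≤ S_ℓ and H ≤ S_n, one has gComp_n(gComp_m(G)) = gComp_n(G) and gPat_ℓ(gPat_m(H)) = gPat_ℓ(H). -/
/-- `τ` is an `ℓ`-pattern of `π`: there is a strictly increasing map `f` such that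
`τ i < τ j ↔ π (f i) < π (f j)` for all `i, j`. -/
def IsPattern {l n : ℕ} (τ : Equiv.Perm (Fin l)) (π : Equiv.Perm (Fin n)) : Prop :=
  ∃ f : Fin l → Fin n, StrictMono f ∧ ∀ i j : Fin l, τ i < τ j ↔ π (f i) < π (f j)

/-- `Comp_n(S)`: permutations of degree `n` all of whose `ℓ`-patterns lie in `S`. -/
def Compn (n : ℕ) {l : ℕ} (S : Set (Equiv.Perm (Fin l))) : Set (Equiv.Perm (Fin n)) :=
  {π | ∀ τ : Equiv.Perm (Fin l), IsPattern τ π → τ ∈ S}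

/-- `Pat_ℓ(T)`: the set of all `ℓ`-patterns of members of `T`. -/
def Patl (l : ℕ) {n : ℕ} (T : Set (Equiv.Perm (Fin n))) : Set (Equiv.Perm (Fin l)) :=
  {τ | ∃ π ∈ T, IsPattern τ π}

/-- `gComp_n(G)`: the subgroup generated by `Comp_n(G)`. -/
def gCompn (n : ℕ) {l : ℕ} (G : Subgroup (Equiv.Perm (Fin l))) :
    Subgroup (Equiv.Perm (Fin n)) :=
  Subgroup.closure (Compn n (G : Set (Equiv.Perm (Fin l))))

/-- `gPat_ℓ(H)`: the subgroup generated by `Pat_ℓ(H)`. -/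
def gPatl (l : ℕ) {n : ℕ} (H : Subgroup (Equiv.Perm (Fin n))) :
    Subgroup (Equiv.Perm (Fin l)) :=
  Subgroup.closure (Patl l (H : Set (Equiv.Perm (Fin n))))

theorem isPattern_iff_exists_strictMono {l n : ℕ} {τ : Equiv.Perm (Fin l)}
    {π : Equiv.Perm (Fin n)} :
    IsPattern τ π ↔
      ∃ f h : Fin l → Fin n, StrictMono f ∧ StrictMono h ∧ ∀ i, π (f i) = h (τ i) := by
  constructor
  · rintro ⟨f, hf, hτ⟩
    refine ⟨f, fun i => π (f (τ⁻¹ i)), hf, fun i j hij => (hτ _ _).1 (by simpa using hij), ?_⟩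
    simp
  · rintro ⟨f, h, hf, hh, hτ⟩
    exact ⟨f, hf, fun i j => by rw [hτ, hτ, hh.lt_iff_lt]⟩

theorem exists_perm_strictMono_of_injective {l n : ℕ} {g : Fin l → Fin n}
    (hg : Function.Injective g) :
    ∃ (ρ : Equiv.Perm (Fin l)) (h : Fin l → Fin n), StrictMono h ∧ ∀ i, g i = h (ρ i) :=
  ⟨(Tuple.sort g)⁻¹, g ∘ Tuple.sort g,
    (Tuple.monotone_sort g).strictMono_of_injective (hg.comp (Tuple.sort g).injective), by simp⟩

theorem StrictMono.exists_fin_factorization {l m n : ℕ} (hlm : l ≤ m) (hmn : m ≤ n)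
    {f : Fin l → Fin n} (hf : StrictMono f) :
    ∃ (p : Fin m → Fin n) (q : Fin l → Fin m),
      StrictMono p ∧ StrictMono q ∧ ∀ i, p (q i) = f i := by
  obtain ⟨A, hA, hcard⟩ := Finset.exists_superset_card_eq
    (s := Finset.univ.image f) (n := m)
    (by rw [Finset.card_image_of_injective _ hf.injective]; simpa using hlm) (by simpa using hmn)
  have hmem : ∀ i, ∃ j, A.orderEmbOfFin hcard j = f i := fun i => by
    have : f i ∈ Set.range (A.orderEmbOfFin hcard) := by
      rw [Finset.range_orderEmbOfFin]
      exact hA (Finset.mem_image_of_mem f (Finset.mem_univ i))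
    exact this
  choose q hq using hmem
  refine ⟨A.orderEmbOfFin hcard, q, (A.orderEmbOfFin hcard).strictMono, fun i j hij => ?_, hq⟩
  rw [← (A.orderEmbOfFin hcard).lt_iff_lt, hq, hq]
  exact hf hij

namespace IsPattern

variable {l m n : ℕ}

theorem trans {τ : Equiv.Perm (Fin l)} {ρ : Equiv.Perm (Fin m)} {π : Equiv.Perm (Fin n)}
    (hτ : IsPattern τ ρ) (hρ : IsPattern ρ π) : IsPattern τ π := by
  obtain ⟨f, hf, hfτ⟩ := hτ
  obtain ⟨g, hg, hgρ⟩ := hρ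
  exact ⟨g ∘ f, hg.comp hf, fun i j => (hfτ i j).trans (hgρ _ _)⟩

theorem inv {τ : Equiv.Perm (Fin l)} {π : Equiv.Perm (Fin n)} (hτ : IsPattern τ π) :
    IsPattern τ⁻¹ π⁻¹ := by
  obtain ⟨f, h, hf, hh, hfh⟩ := isPattern_iff_exists_strictMono.1 hτ
  refine isPattern_iff_exists_strictMono.2 ⟨h, f, hh, hf, fun i => ?_⟩
  simp [Equiv.symm_apply_eq, hfh]

/-- A pattern of a product is a product of patterns of the factors. -/
theorem exists_mul_eq {τ : Equiv.Perm (Fin l)} {π σ : Equiv.Perm (Fin n)}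
    (hτ : IsPattern τ (π * σ)) : ∃ μ ρ, IsPattern μ π ∧ IsPattern ρ σ ∧ μ * ρ = τ := by
  obtain ⟨f, k, hf, hk, hfk⟩ := isPattern_iff_exists_strictMono.1 hτ
  obtain ⟨ρ, h, hh, hσ⟩ := exists_perm_strictMono_of_injective (σ.injective.comp hf.injective)
  refine ⟨τ * ρ⁻¹, ρ, isPattern_iff_exists_strictMono.2 ⟨h, k, hh, hk, fun i => ?_⟩,
    isPattern_iff_exists_strictMono.2 ⟨f, h, hf, hh, hσ⟩, by simp⟩
  have h₁ := hσ (ρ⁻¹ i)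
  have h₂ := hfk (ρ⁻¹ i)
  simp only [Function.comp_apply, Equiv.Perm.coe_inv, Equiv.apply_symm_apply,
    Equiv.Perm.mul_apply] at h₁ h₂ ⊢
  rw [← h₁, h₂]

/-- A pattern factors through a pattern of any intermediate length. -/
theorem exists_intermediate (hlm : l ≤ m) (hmn : m ≤ n) {τ : Equiv.Perm (Fin l)}
    {π : Equiv.Perm (Fin n)} (hτ : IsPattern τ π) :
    ∃ ρ : Equiv.Perm (Fin m), IsPattern τ ρ ∧ IsPattern ρ π := by
  obtain ⟨f, hf, hfτ⟩ := hτ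
  obtain ⟨p, q, hp, hq, hpq⟩ := hf.exists_fin_factorization hlm hmn
  obtain ⟨ρ, h, hh, hπ⟩ := exists_perm_strictMono_of_injective (π.injective.comp hp.injective)
  refine ⟨ρ, ⟨q, hq, fun i j => ?_⟩, isPattern_iff_exists_strictMono.2 ⟨p, h, hp, hh, hπ⟩⟩
  rw [hfτ, ← hh.lt_iff_lt, ← hπ, ← hπ]
  simp [hpq]

theorem eq_one {τ : Equiv.Perm (Fin l)} (hτ : IsPattern τ (1 : Equiv.Perm (Fin n))) : τ = 1 := by
  obtain ⟨f, hf, hfτ⟩ := hτ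
  have hmono : StrictMono τ := fun i j hij => (hfτ i j).2 (hf hij)
  ext i
  simpa using congrArg Fin.val (congrFun (hmono.range_inj strictMono_id |>.1 (by simp)) i)

end IsPattern

/-- The permutations all of whose patterns lie in a subgroup form a subgroup. -/
theorem coe_gCompn (n : ℕ) {l : ℕ} (G : Subgroup (Equiv.Perm (Fin l))) :
    (gCompn n G : Set (Equiv.Perm (Fin n))) = Compn n (G : Set (Equiv.Perm (Fin l))) := by
  refine Set.Subset.antisymm (fun π hπ => ?_) Subgroup.subset_closure
  induction hπ using Subgroup.closure_induction with
  | mem π hπ => exact hπ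
  | one => exact fun τ hτ => hτ.eq_one ▸ G.one_mem
  | mul π σ _ _ hπ hσ =>
    intro τ hτ
    obtain ⟨μ, ρ, hμ, hρ, rfl⟩ := hτ.exists_mul_eq
    exact G.mul_mem (hπ μ hμ) (hσ ρ hρ)
  | inv π _ hπ => exact fun τ hτ => G.inv_mem_iff.1 (hπ _ (inv_inv π ▸ hτ.inv))

theorem mem_gCompn {n l : ℕ} {G : Subgroup (Equiv.Perm (Fin l))} {π : Equiv.Perm (Fin n)} :
    π ∈ gCompn n G ↔ ∀ τ : Equiv.Perm (Fin l), IsPattern τ π → τ ∈ G := by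
  rw [← SetLike.mem_coe, coe_gCompn]
  rfl

theorem gc_gPatl_gCompn (l n : ℕ) :
    GaloisConnection (gPatl l : Subgroup (Equiv.Perm (Fin n)) → Subgroup (Equiv.Perm (Fin l)))
      (gCompn n) := fun H G => by
  rw [gPatl, Subgroup.closure_le]
  exact ⟨fun h π hπ => mem_gCompn.2 fun τ hτ => h ⟨π, hπ, hτ⟩,
    fun h τ ⟨π, hπ, hτ⟩ => mem_gCompn.1 (h hπ) τ hτ⟩

theorem gCompn_gCompn {l m n : ℕ} (hlm : l ≤ m) (hmn : m ≤ n)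
    (G : Subgroup (Equiv.Perm (Fin l))) : gCompn n (gCompn m G) = gCompn n G := by
  ext π
  simp only [mem_gCompn]
  constructor
  · intro h τ hτ
    obtain ⟨ρ, hτρ, hρπ⟩ := hτ.exists_intermediate hlm hmn
    exact h ρ hρπ τ hτρ
  · exact fun h ρ hρ τ hτ => h τ (hτ.trans hρ)

theorem gComp_gComp_eq_gComp_and_gPat_gPat_eq_gPat {l m n : ℕ} (hl : 0 < l) (hlm : l ≤ m)
    (hmn : m ≤ n) (G : Subgroup (Equiv.Perm (Fin l))) (H : Subgroup (Equiv.Perm (Fin n))) :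
    gCompn n (gCompn m G) = gCompn n G ∧ gPatl l (gPatl m H) = gPatl l H :=
  ⟨gCompn_gCompn hlm hmn G,
    ((gc_gPatl_gCompn m n).compose (gc_gPatl_gCompn l m)).l_unique (gc_gPatl_gCompn l n)
      (gCompn_gCompn hlm hmn)⟩
end

section
/- Let G be a subgroup of the symmetric group S_n. Then the following three statements are equivalent: (a) C_n ≤ G; (b) C_{n+1} ≤ Comp_{n+1}(G); (c) Comp_{n+1}(G) contains a permutation belonging to C_{n+1} that is not the identity permutation. -/
/-- The natural cyclic group `C_k`, generated by the natural cycle `ζ_k = finRotate k`. -/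
def naturalCyclic (k : ℕ) : Subgroup (Equiv.Perm (Fin k)) :=
  Subgroup.zpowers (finRotate k)

theorem val_finRotate_pow_apply {n : ℕ} (k : ℕ) (i : Fin n) :
    ((finRotate n ^ k) i : ℕ) = (i + k) % n := by
  obtain _ | m := n
  · exact i.elim0
  induction k with
  | zero => simp [Nat.mod_eq_of_lt i.isLt]
  | succ k ih =>
    rw [pow_succ', Equiv.Perm.mul_apply, finRotate_apply, Fin.val_add, ih]
    simp [Nat.add_assoc]

theorem mem_naturalCyclic_iff {n : ℕ} {π : Equiv.Perm (Fin (n + 1))} :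
    π ∈ naturalCyclic (n + 1) ↔ ∃ k ≤ n, finRotate (n + 1) ^ k = π := by
  constructor
  · intro h
    obtain ⟨k, rfl⟩ := mem_powers_iff_mem_zpowers.mpr h
    refine ⟨k % (n + 1), Nat.le_of_lt_succ (Nat.mod_lt _ n.succ_pos), ?_⟩
    ext i
    simp [val_finRotate_pow_apply]
  · rintro ⟨k, -, rfl⟩
    exact Subgroup.npow_mem_zpowers _ k

theorem StrictMono.exists_eq_succAbove {n : ℕ} {f : Fin n → Fin (n + 1)} (hf : StrictMono f) :
    ∃ p : Fin (n + 1), f = p.succAbove := by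
  have hns : ¬ Function.Surjective f := fun h => by
    simpa using Fintype.card_le_of_surjective f h
  obtain ⟨p, hp⟩ := not_forall.mp hns
  choose g hg using fun i => Fin.exists_succAbove_eq (y := p) (x := f i) fun h => hp ⟨i, h⟩
  have hgm : StrictMono g := fun i j hij => by
    rw [← (Fin.strictMono_succAbove p).lt_iff_lt, hg, hg]
    exact hf hij
  have hgid : g = id := (hgm.range_inj strictMono_id).mp <| by
    rw [(Finite.surjective_of_injective hgm.injective).range_eq, Set.range_id]
  exact ⟨p, funext fun i => by rw [← hg i, hgid, id]⟩

/-- The `n`-patterns of a permutation of degree `n + 1` arise by deleting one entry. -/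
theorem isPattern_iff_exists_succAbove {n : ℕ} {τ : Equiv.Perm (Fin n)}
    {π : Equiv.Perm (Fin (n + 1))} :
    IsPattern τ π ↔ ∃ p : Fin (n + 1), ∀ i, π (p.succAbove i) = (π p).succAbove (τ i) := by
  constructor
  · rintro ⟨f, hf, h⟩
    obtain ⟨p, rfl⟩ := hf.exists_eq_succAbove
    refine ⟨p, ?_⟩
    have hmono : StrictMono fun i => π (p.succAbove (τ.symm i)) := fun i j hij => by
      rw [← h]
      simpa using hij
    obtain ⟨q, hq⟩ := hmono.exists_eq_succAbove
    have hqp : π p = q := by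
      by_contra hne
      obtain ⟨i, hi⟩ := Fin.exists_succAbove_eq hne
      rw [← hq] at hi
      exact Fin.succAbove_ne p _ (π.injective hi)
    intro i
    rw [hqp, ← hq]
    simp
  · rintro ⟨p, h⟩
    refine ⟨p.succAbove, Fin.strictMono_succAbove p, fun i j => ?_⟩
    rw [h, h, (Fin.strictMono_succAbove _).lt_iff_lt]

/-- Deleting the entry at position `p` of a rotation by `k` leaves a rotation by `k` or `k - 1`,
according to whether the deleted entry lies before or after the descent. -/
theorem finRotate_pow_succAbove {n k : ℕ} (hk : k ≤ n) (p : Fin (n + 1)) (i : Fin n) :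
    (finRotate (n + 1) ^ k) (p.succAbove i) =
      ((finRotate (n + 1) ^ k) p).succAbove
        ((finRotate n ^ (if (p : ℕ) + k ≤ n then k else k - 1)) i) := by
  have mod_eq (a m : ℕ) (h : a < 2 * m) : a % m = if a < m then a else a - m := by
    split_ifs with h'
    · exact Nat.mod_eq_of_lt h'
    · rw [Nat.mod_eq_sub_mod (by omega), Nat.mod_eq_of_lt (by omega)]
  have hp := p.isLt
  have hi := i.isLt
  ext
  rw [val_finRotate_pow_apply]
  simp only [Fin.succAbove, Fin.lt_def, Fin.val_castSucc, apply_ite Fin.val, Fin.val_succ,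
    val_finRotate_pow_apply]
  rw [mod_eq (p + k) _ (by omega), mod_eq (i + _) n (by split_ifs <;> omega),
    mod_eq (_ + k) _ (by split_ifs <;> omega)]
  split_ifs <;> omega

theorem isPattern_finRotate_pow_iff {n k : ℕ} (hk : k ≤ n) {τ : Equiv.Perm (Fin n)} :
    IsPattern τ (finRotate (n + 1) ^ k) ↔
      ∃ p : Fin (n + 1), τ = finRotate n ^ (if (p : ℕ) + k ≤ n then k else k - 1) := by
  rw [isPattern_iff_exists_succAbove]
  refine exists_congr fun p => ?_
  simp only [finRotate_pow_succAbove hk, Fin.succAbove_right_inj, Equiv.ext_iff, eq_comm]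

theorem cyclic_le_iff_cyclic_le_comp_iff_exists {n : ℕ} (hn : 0 < n)
    (G : Subgroup (Equiv.Perm (Fin n))) :
    (naturalCyclic n ≤ G ↔
      (naturalCyclic (n + 1) : Set (Equiv.Perm (Fin (n + 1)))) ⊆
        Compn (n + 1) (G : Set (Equiv.Perm (Fin n)))) ∧
    ((naturalCyclic (n + 1) : Set (Equiv.Perm (Fin (n + 1)))) ⊆
        Compn (n + 1) (G : Set (Equiv.Perm (Fin n))) ↔
      ∃ π ∈ Compn (n + 1) (G : Set (Equiv.Perm (Fin n))),
        π ∈ naturalCyclic (n + 1) ∧ π ≠ 1) := by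
  have hab : naturalCyclic n ≤ G → (naturalCyclic (n + 1) : Set (Equiv.Perm (Fin (n + 1)))) ⊆
      Compn (n + 1) (G : Set (Equiv.Perm (Fin n))) := by
    intro h π hπ τ hτ
    obtain ⟨k, hk, rfl⟩ := mem_naturalCyclic_iff.mp hπ
    obtain ⟨p, rfl⟩ := (isPattern_finRotate_pow_iff hk).mp hτ
    exact h (Subgroup.npow_mem_zpowers _ _)
  have hbc : (naturalCyclic (n + 1) : Set (Equiv.Perm (Fin (n + 1)))) ⊆
      Compn (n + 1) (G : Set (Equiv.Perm (Fin n))) →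
      ∃ π ∈ Compn (n + 1) (G : Set (Equiv.Perm (Fin n))),
        π ∈ naturalCyclic (n + 1) ∧ π ≠ 1 := by
    intro h
    have hmem : finRotate (n + 1) ∈ naturalCyclic (n + 1) := Subgroup.mem_zpowers _
    refine ⟨_, h hmem, hmem, fun h1 => ?_⟩
    have h0 := val_finRotate_pow_apply 1 (0 : Fin (n + 1))
    rw [h1] at h0
    simp [Nat.mod_eq_of_lt (Nat.succ_lt_succ hn)] at h0
  have hca : (∃ π ∈ Compn (n + 1) (G : Set (Equiv.Perm (Fin n))),
      π ∈ naturalCyclic (n + 1) ∧ π ≠ 1) → naturalCyclic n ≤ G := by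
    rintro ⟨π, hπ, hmem, hne⟩
    obtain ⟨k, hk, rfl⟩ := mem_naturalCyclic_iff.mp hmem
    obtain _ | k := k
    · simp at hne
    have hfirst : finRotate n ^ (k + 1) ∈ G :=
      hπ _ ((isPattern_finRotate_pow_iff hk).mpr ⟨0, by simp [hk]⟩)
    have hlast : finRotate n ^ k ∈ G :=
      hπ _ ((isPattern_finRotate_pow_iff hk).mpr ⟨Fin.last n, by simp⟩)
    rw [pow_succ'] at hfirst
    exact Subgroup.zpowers_le.mpr ((G.mul_mem_cancel_right hlast).mp hfirst)
  exact ⟨⟨hab, hca ∘ hbc⟩, ⟨hbc, hab ∘ hca⟩⟩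
end

section
/- For every positive integer n, Comp_{n+1}(A_n) = (S_{OE} ∩ A_{n+1}) ∪ (X ∩ (S_{n+1} \ A_{n+1})), where S_{OE} is the set of permutations π of {1,…,n+1} such that π(i) and i have the same parity for all i, and X is the set of permutations π of {1,…,n+1} such that for all i, π(i) is odd if and only if i is even. -/
open Equiv in
/-- Deleting the entry at position `p` from a permutation `π` leaves a permutation whose sign
is that of `π` times `(-1) ^ (p + π p)`. -/
theorem exists_perm_succAbove_sign {n : ℕ} (π : Perm (Fin (n + 1))) (p : Fin (n + 1)) :
    ∃ e : Perm (Fin n), (∀ j, π (p.succAbove j) = (π p).succAbove (e j)) ∧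
      Perm.sign e = Perm.sign π * (-1) ^ ((p : ℕ) + (π p : ℕ)) := by
  set σ : Perm (Fin (n + 1)) := (π p).cycleRange * π * p.cycleRange⁻¹ with hσ
  obtain ⟨⟨a, e⟩, hae⟩ := Perm.decomposeFin.symm.surjective σ
  have h0 : σ 0 = 0 := by simp [hσ]
  have ha : a = 0 := by
    rw [← hae, Perm.decomposeFin_symm_apply_zero] at h0
    exact h0
  subst ha
  refine ⟨e, fun j => ?_, ?_⟩
  · have h := congrArg (fun s : Perm (Fin (n + 1)) => s j.succ) hae
    have hp : p.cycleRange⁻¹ j.succ = p.succAbove j := by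
      rw [Perm.inv_eq_iff_eq, Fin.cycleRange_succAbove]
    simp only [Perm.decomposeFin_symm_apply_succ, swap_self, refl_apply, hσ, Perm.mul_apply,
      hp] at h
    apply (π p).cycleRange.injective
    rw [← h, Fin.cycleRange_succAbove]
  · have h := congrArg Perm.sign hae
    rw [Perm.decomposeFin.symm_sign, if_pos rfl, one_mul, hσ, map_mul, map_mul, Perm.sign_inv,
      Fin.sign_cycleRange, Fin.sign_cycleRange] at h
    rw [h, pow_add]
    ac_rfl

theorem Equiv.Perm.eq_of_lt_iff_lt {n : ℕ} {τ e : Equiv.Perm (Fin n)}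
    (h : ∀ i j, τ i < τ j ↔ e i < e j) : τ = e := by
  have hm : StrictMono (τ * e⁻¹) := fun i j hij => by
    simpa [h] using hij
  have hid : ⇑(τ * e⁻¹) = id :=
    (hm.range_inj strictMono_id).1 (by rw [(τ * e⁻¹).surjective.range_eq, Set.range_id])
  exact mul_inv_eq_one.1 (Equiv.ext fun i => congrFun hid i)

theorem mem_compn_alternatingGroup_iff {n : ℕ} (π : Equiv.Perm (Fin (n + 1))) :
    π ∈ Compn (n + 1) (alternatingGroup (Fin n) : Set (Equiv.Perm (Fin n))) ↔
      ∀ p : Fin (n + 1), Equiv.Perm.sign π = (-1) ^ ((p : ℕ) + (π p : ℕ)) := by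
  have key (u : ℤˣ) (k : ℕ) : u * (-1) ^ k = 1 ↔ u = (-1) ^ k := by
    rw [mul_eq_one_iff_eq_inv, Int.units_inv_eq_self]
  constructor
  · intro h p
    obtain ⟨e, he, hs⟩ := exists_perm_succAbove_sign π p
    have := h e ⟨p.succAbove, Fin.strictMono_succAbove p, fun i j => by
      rw [he, he, Fin.succAbove_lt_succAbove_iff]⟩
    rw [SetLike.mem_coe, Equiv.Perm.mem_alternatingGroup, hs, key] at this
    exact this
  · rintro h τ ⟨f, hf, hτ⟩
    obtain ⟨p, rfl⟩ := hf.exists_eq_succAbove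
    obtain ⟨e, he, hs⟩ := exists_perm_succAbove_sign π p
    have : τ = e := Equiv.Perm.eq_of_lt_iff_lt fun i j => by
      rw [hτ, he, he, Fin.succAbove_lt_succAbove_iff]
    rw [SetLike.mem_coe, Equiv.Perm.mem_alternatingGroup, this, hs, key]
    exact h p

theorem comp_alternating (n : ℕ) (hn : 0 < n) :
    Compn (n + 1) ((alternatingGroup (Fin n) : Set (Equiv.Perm (Fin n)))) =
      ({π : Equiv.Perm (Fin (n + 1)) | ∀ i, ((π i : ℕ)) % 2 = ((i : ℕ)) % 2} ∩
        (alternatingGroup (Fin (n + 1)) : Set (Equiv.Perm (Fin (n + 1))))) ∪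
      ({π : Equiv.Perm (Fin (n + 1)) | ∀ i, (Odd ((π i : ℕ) + 1) ↔ Even ((i : ℕ) + 1))} ∩
        (alternatingGroup (Fin (n + 1)) : Set (Equiv.Perm (Fin (n + 1))))ᶜ) := by
  ext π
  have hne : (-1 : ℤˣ) ≠ 1 := by decide
  simp only [mem_compn_alternatingGroup_iff, Set.mem_union, Set.mem_inter_iff, Set.mem_ofPred_eq,
    Set.mem_compl_iff, SetLike.mem_coe, Equiv.Perm.mem_alternatingGroup]
  rcases Int.units_eq_one_or (Equiv.Perm.sign π) with h | h
  · simp only [h, and_true, not_true_eq_false, and_false, or_false]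
    refine forall_congr' fun i => ?_
    rw [eq_comm, neg_one_pow_eq_one_iff_even hne, Nat.even_iff]
    lia
  · simp only [h, hne, and_false, not_false_eq_true, and_true, false_or]
    refine forall_congr' fun i => ?_
    rw [eq_comm, neg_one_pow_eq_neg_one_iff_odd hne, Nat.odd_iff, Nat.odd_iff, Nat.even_iff]
    lia
end

section
/- Let G be a subgroup of the symmetric group S_n containing the natural cycle ζ_n. If D_n ≤ G and G is neither S_n nor the alternating group A_n, then Comp_{n+1}(G) = D_{n+1}. -/
/-- The descending permutation `δ_n : i ↦ n + 1 - i` (zero-based: `i ↦ n - 1 - i`). -/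
def descPerm (n : ℕ) : Equiv.Perm (Fin n) :=
  Function.Involutive.toPerm Fin.rev fun i => Fin.rev_rev i

/-- The natural dihedral group `D_k = ⟨ζ_k, δ_k⟩`. -/
def naturalDihedral (k : ℕ) : Subgroup (Equiv.Perm (Fin k)) :=
  Subgroup.closure {finRotate k, descPerm k}

open Equiv

/-! ### Deleting one point from a permutation -/

/-- The pattern of `π` obtained by deleting the position `p` together with the value `π p`. -/
def deletePoint {n : ℕ} (π : Perm (Fin (n + 1))) (p : Fin (n + 1)) : Perm (Fin n) :=
  (finSuccAboveEquiv p).trans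
    ((π.subtypeEquiv (p := (· ≠ p)) (q := (· ≠ π p)) fun _ => π.injective.ne_iff.symm).trans
      (finSuccAboveEquiv (π p)).symm)

theorem succAbove_deletePoint {n : ℕ} (π : Perm (Fin (n + 1))) (p : Fin (n + 1)) (i : Fin n) :
    (π p).succAbove (deletePoint π p i) = π (p.succAbove i) := by
  have h := congrArg Subtype.val ((finSuccAboveEquiv (π p)).apply_symm_apply
    (π.subtypeEquiv (p := (· ≠ p)) (q := (· ≠ π p)) (fun _ => π.injective.ne_iff.symm)
      (finSuccAboveEquiv p i)))
  exact h

theorem deletePoint_eq_of_succAbove {n : ℕ} {π : Perm (Fin (n + 1))} {p : Fin (n + 1)}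
    {τ : Perm (Fin n)} (h : ∀ i, (π p).succAbove (τ i) = π (p.succAbove i)) :
    deletePoint π p = τ :=
  Equiv.ext fun i => Fin.succAbove_right_injective ((succAbove_deletePoint π p i).trans (h i).symm)

theorem deletePoint_one {n : ℕ} (p : Fin (n + 1)) : deletePoint 1 p = 1 :=
  deletePoint_eq_of_succAbove fun _ => rfl

theorem deletePoint_mul {n : ℕ} (π ρ : Perm (Fin (n + 1))) (p : Fin (n + 1)) :
    deletePoint (π * ρ) p = deletePoint π (ρ p) * deletePoint ρ p :=
  deletePoint_eq_of_succAbove fun i => by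
    simp only [Perm.mul_apply, succAbove_deletePoint]

theorem deletePoint_inv {n : ℕ} (π : Perm (Fin (n + 1))) (p : Fin (n + 1)) :
    deletePoint π⁻¹ p = (deletePoint π (π⁻¹ p))⁻¹ := by
  rw [eq_inv_iff_mul_eq_one]
  have h := deletePoint_mul π⁻¹ π (π⁻¹ p)
  rw [inv_mul_cancel, deletePoint_one] at h
  simpa using h.symm

theorem isPattern_iff_exists_deletePoint {n : ℕ} {τ : Perm (Fin n)} {π : Perm (Fin (n + 1))} :
    IsPattern τ π ↔ ∃ p, deletePoint π p = τ := by
  constructor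
  · rintro ⟨f, hf, h⟩
    obtain ⟨p, hp⟩ : ∃ p, ∀ i, f i ≠ p := by
      by_contra! hsurj
      have := Fintype.card_le_of_surjective f hsurj
      simp at this
    have hrange : ∀ {g : Fin n → Fin (n + 1)} {q : Fin (n + 1)}, Function.Injective g →
        (∀ i, g i ≠ q) → Set.range g = {q}ᶜ := by
      intro g q hg hq
      refine Set.eq_of_subset_of_ncard_le (by rintro _ ⟨i, rfl⟩; exact hq i) ?_
      rw [Set.ncard_compl, Set.ncard_singleton, ← Set.image_univ, Set.ncard_image_of_injective _ hg,
        Set.ncard_univ]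
      simp
    have hfp : f = p.succAbove := (hf.range_inj p.strictMono_succAbove).1
      ((hrange hf.injective hp).trans (hrange p.succAbove_right_injective p.succAbove_ne).symm)
    have hmono : StrictMono fun y => π (f (τ⁻¹ y)) := fun y z hyz =>
      (h _ _).1 (by simpa using hyz)
    have hval : (fun y => π (f (τ⁻¹ y))) = (π p).succAbove :=
      (hmono.range_inj (π p).strictMono_succAbove).1
        ((hrange hmono.injective fun y => π.injective.ne (hp _)).trans
          (hrange (π p).succAbove_right_injective (π p).succAbove_ne).symm)
    refine ⟨p, deletePoint_eq_of_succAbove fun i => ?_⟩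
    rw [← hval, ← hfp]
    simp
  · rintro ⟨p, rfl⟩
    refine ⟨p.succAbove, p.strictMono_succAbove, fun i j => ?_⟩
    rw [← succAbove_deletePoint, ← succAbove_deletePoint, Fin.succAbove_lt_succAbove_iff]

/-- For a subgroup `G`, the set `Comp_{n+1}(G)` as a subgroup. -/
def compSubgroup {n : ℕ} (G : Subgroup (Perm (Fin n))) : Subgroup (Perm (Fin (n + 1))) where
  carrier := {π | ∀ p, deletePoint π p ∈ G}
  mul_mem' hπ hρ p := by
    rw [deletePoint_mul]
    exact G.mul_mem (hπ _) (hρ _)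
  one_mem' p := by
    rw [deletePoint_one]
    exact G.one_mem
  inv_mem' hπ p := by
    rw [deletePoint_inv]
    exact G.inv_mem (hπ _)

theorem mem_compSubgroup {n : ℕ} {G : Subgroup (Perm (Fin n))} {π : Perm (Fin (n + 1))} :
    π ∈ compSubgroup G ↔ ∀ p, deletePoint π p ∈ G :=
  Iff.rfl

theorem compn_succ_eq_compSubgroup {n : ℕ} (G : Subgroup (Perm (Fin n))) :
    Compn (n + 1) (G : Set (Perm (Fin n))) = compSubgroup G := by
  ext π
  simp [Compn, isPattern_iff_exists_deletePoint, mem_compSubgroup]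

/-! ### The dihedral group -/

theorem finRotate_mem_naturalDihedral (k : ℕ) : finRotate k ∈ naturalDihedral k :=
  Subgroup.subset_closure (by simp)

theorem descPerm_mem_naturalDihedral (k : ℕ) : descPerm k ∈ naturalDihedral k :=
  Subgroup.subset_closure (by simp)

theorem finRotate_pow_apply {n : ℕ} (m : ℕ) (x : Fin (n + 1)) :
    (finRotate (n + 1) ^ m) x = x + m • 1 := by
  induction m with
  | zero => simp
  | succ m ih => rw [pow_succ', Perm.mul_apply, ih, finRotate_apply, succ_nsmul, add_assoc]

theorem Fin.nsmul_one_val {n : ℕ} (x : Fin (n + 1)) : (x : ℕ) • (1 : Fin (n + 1)) = x := by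
  induction x using Fin.induction with
  | zero => simp
  | succ i ih =>
    rw [Fin.val_castSucc] at ih
    rw [Fin.val_succ, succ_nsmul, ih, Fin.coeSucc_eq_succ]

theorem addRight_mem_naturalDihedral {n : ℕ} (a : Fin (n + 1)) :
    Equiv.addRight a ∈ naturalDihedral (n + 1) := by
  have h : Equiv.addRight a = finRotate (n + 1) ^ (a : ℕ) := by
    ext1 x
    rw [finRotate_pow_apply, Fin.nsmul_one_val, Equiv.coe_addRight]
  rw [h]
  exact pow_mem (finRotate_mem_naturalDihedral _) _

theorem neg_mem_naturalDihedral (n : ℕ) :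
    Equiv.neg (Fin (n + 1)) ∈ naturalDihedral (n + 1) := by
  have h : Equiv.neg (Fin (n + 1)) = finRotate (n + 1) * descPerm (n + 1) := by
    ext1 x
    rw [Perm.mul_apply, finRotate_apply, Equiv.neg_apply]
    change -x = x.rev + 1
    rw [← Fin.last_sub, neg_eq_iff_eq_neg.1 (Fin.neg_last n)]
    abel
  rw [h]
  exact mul_mem (finRotate_mem_naturalDihedral _) (descPerm_mem_naturalDihedral _)

theorem deletePoint_descPerm {n : ℕ} (p : Fin (n + 1)) :
    deletePoint (descPerm (n + 1)) p = descPerm n :=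
  deletePoint_eq_of_succAbove fun i => (Fin.rev_succAbove p i).symm

theorem deletePoint_finRotate_last (n : ℕ) :
    deletePoint (finRotate (n + 1)) (Fin.last n) = 1 :=
  deletePoint_eq_of_succAbove fun i => by simp

theorem deletePoint_finRotate_castSucc {n : ℕ} (p : Fin n) :
    deletePoint (finRotate (n + 1)) p.castSucc = finRotate n :=
  deletePoint_eq_of_succAbove fun i => by
    obtain ⟨n, rfl⟩ : ∃ m, n = m + 1 := ⟨n - 1, by have := p.isLt; lia⟩
    ext
    rw [coe_finRotate, finRotate_apply, Fin.coeSucc_eq_succ]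
    simp only [Fin.succAbove, Fin.lt_def, Fin.ext_iff, Fin.val_last, Fin.val_succ,
      Fin.val_castSucc, coe_finRotate, apply_ite Fin.val]
    have := p.isLt
    have := i.isLt
    split_ifs <;> lia

theorem naturalDihedral_succ_le_compSubgroup {n : ℕ} {G : Subgroup (Perm (Fin n))}
    (hG : naturalDihedral n ≤ G) : naturalDihedral (n + 1) ≤ compSubgroup G := by
  rw [naturalDihedral, Subgroup.closure_le]
  rintro _ (rfl | rfl)
  · intro p
    induction p using Fin.lastCases with
    | last => rw [deletePoint_finRotate_last]; exact G.one_mem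
    | cast p =>
      rw [deletePoint_finRotate_castSucc]
      exact hG (finRotate_mem_naturalDihedral n)
  · intro p
    rw [deletePoint_descPerm]
    exact hG (descPerm_mem_naturalDihedral n)

/-! ### Groups generated by the natural cycle and a shorter cycle of consecutive points -/

/-- A group containing the products of any two cyclically adjacent transpositions has index at
most two. -/
theorem eq_top_or_eq_alternatingGroup_of_swap_mul_swap_mem {n : ℕ}
    {G : Subgroup (Perm (Fin (n + 1)))}
    (hG : ∀ x : Fin (n + 1), swap x (x + 1) * swap (x + 1) (x + 1 + 1) ∈ G) :
    G = ⊤ ∨ G = alternatingGroup (Fin (n + 1)) := by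
  set s : Perm (Fin (n + 1)) := swap 0 (0 + 1) with hs
  have hss : s * s = 1 := swap_mul_self _ _
  have hzero : ∀ x : Fin (n + 1), s * swap x (x + 1) ∈ G := by
    intro x
    induction x using Fin.induction with
    | zero => rw [← hs, hss]; exact G.one_mem
    | succ i ih =>
      rw [← Fin.coeSucc_eq_succ]
      have := G.mul_mem ih (hG i.castSucc)
      rwa [mul_assoc, swap_mul_self_mul] at this
  have hor : ∀ g : Perm (Fin (n + 1)), s * g ∈ G ∨ g ∈ G := by
    intro g
    have hg : g ∈ Submonoid.closure
        (Set.range fun i : Fin n => swap i.castSucc i.succ) := by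
      rw [Perm.mclosure_swap_castSucc_succ]
      trivial
    induction hg using Submonoid.closure_induction_left with
    | one => exact Or.inr G.one_mem
    | mul_left x hx y _ ih =>
      obtain ⟨i, rfl⟩ := hx
      have h := hzero i.castSucc
      rw [Fin.coeSucc_eq_succ] at h
      rcases ih with ih | ih
      · right
        have := G.mul_mem (G.inv_mem h) ih
        rwa [mul_inv_rev, swap_inv, mul_assoc, ← mul_assoc s⁻¹, inv_mul_cancel, one_mul] at this
      · left
        rw [← mul_assoc]
        exact G.mul_mem h ih
  by_cases hsG : s ∈ G
  · left
    refine eq_top_iff.2 fun g _ => (hor g).elim (fun h => ?_) id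
    exact (G.mul_mem_cancel_left hsG).1 h
  · right
    refine Perm.eq_alternatingGroup_of_index_eq_two (Subgroup.index_eq_two_iff'.2 ⟨s, fun g => ?_⟩)
    rw [xor_iff_or_and_not_and]
    exact ⟨hor g, fun h => hsG ((G.mul_mem_cancel_right h.2).1 h.1)⟩

theorem coe_cycleRange {n : ℕ} (i j : Fin (n + 1)) :
    (Fin.cycleRange i j : ℕ) =
      if (j : ℕ) < i then (j : ℕ) + 1 else if (j : ℕ) = i then 0 else j := by
  split_ifs with h₁ h₂
  · exact Fin.coe_cycleRange_of_lt h₁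
  · rw [Fin.cycleRange_of_eq (Fin.ext h₂)]; rfl
  · rw [Fin.cycleRange_of_gt (Fin.lt_def.2 (by lia))]

theorem coe_finRotate_conj_cycleRange {n : ℕ} {k : Fin (n + 1)} (hk : k < Fin.last n)
    (j : Fin (n + 1)) :
    ((finRotate (n + 1) * Fin.cycleRange k * (finRotate (n + 1))⁻¹) j : ℕ) =
      if (j : ℕ) = 0 then 0 else if (j : ℕ) ≤ k then (j : ℕ) + 1
        else if (j : ℕ) = k + 1 then 1 else j := by
  obtain ⟨i, rfl⟩ := (finRotate (n + 1)).surjective j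
  rw [Perm.mul_apply, Perm.mul_apply, Perm.inv_def, symm_apply_apply]
  simp only [coe_finRotate, Fin.ext_iff, coe_cycleRange, Fin.val_last]
  have := i.isLt
  have : (k : ℕ) < n := hk
  split_ifs <;> lia

theorem swap_mul_swap_eq_of_cycleRange {n : ℕ} {k : Fin (n + 1)} (hk₀ : k ≠ 0)
    (hk : k < Fin.last n) :
    swap (k - 1) k * swap k (k + 1) =
      (Fin.cycleRange k)⁻¹ *
        (finRotate (n + 1) * Fin.cycleRange k * (finRotate (n + 1))⁻¹)⁻¹ *
        Fin.cycleRange k * Fin.cycleRange k := by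
  rw [← mul_inv_rev, mul_assoc, eq_inv_mul_iff_mul_eq]
  ext j
  have hk' : (k : ℕ) < n := hk
  have hk₀' : (k : ℕ) ≠ 0 := fun h => hk₀ (Fin.ext h)
  have hsucc : ((k + 1 : Fin (n + 1)) : ℕ) = k + 1 := Fin.val_add_one_of_lt hk
  have hpred : ((k - 1 : Fin (n + 1)) : ℕ) = k - 1 := Fin.val_sub_one_of_ne_zero hk₀
  have hswap : ((swap (k - 1) k * swap k (k + 1)) j : ℕ) = if (j : ℕ) + 1 = k then (k : ℕ)
      else if (j : ℕ) = k then k + 1 else if (j : ℕ) = k + 1 then k - 1 else j := by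
    simp only [Perm.mul_apply, swap_apply_def, Fin.ext_iff, apply_ite Fin.val, hsucc, hpred]
    split_ifs <;> lia
  rw [Perm.mul_apply, Perm.mul_apply, Perm.mul_apply (Fin.cycleRange k),
    coe_finRotate_conj_cycleRange hk]
  simp only [coe_cycleRange, hswap]
  grind

theorem eq_top_or_eq_alternatingGroup_of_cycleRange_mem {n : ℕ}
    {G : Subgroup (Perm (Fin (n + 1)))} (hζ : finRotate (n + 1) ∈ G) {k : Fin (n + 1)}
    (hk₀ : k ≠ 0) (hk : k < Fin.last n) (hkG : Fin.cycleRange k ∈ G) :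
    G = ⊤ ∨ G = alternatingGroup (Fin (n + 1)) := by
  have hmem : swap (k - 1) k * swap k (k + 1) ∈ G := by
    rw [swap_mul_swap_eq_of_cycleRange hk₀ hk]
    have hconj := G.mul_mem (G.mul_mem hζ hkG) (G.inv_mem hζ)
    exact G.mul_mem (G.mul_mem (G.mul_mem (G.inv_mem hkG) (G.inv_mem hconj)) hkG) hkG
  refine eq_top_or_eq_alternatingGroup_of_swap_mul_swap_mem fun x => ?_
  set r := finRotate (n + 1) ^ ((x - (k - 1) : Fin (n + 1)) : ℕ) with hr
  have hrG : r ∈ G := pow_mem hζ _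
  have hrx : ∀ y, r y = y + (x - (k - 1)) := fun y => by
    rw [hr, finRotate_pow_apply, Fin.nsmul_one_val]
  have h := G.mul_mem (G.mul_mem hrG hmem) (G.inv_mem hrG)
  rw [← conj_mul, ← swap_apply_apply, ← swap_apply_apply, hrx, hrx, hrx] at h
  convert h using 3 <;> abel

/-! ### Rigidity of adjacency -/

theorem cycleRange_mul_deletePoint_zero {n : ℕ} {ρ : Perm (Fin (n + 2))} (h₀ : ρ 0 = 0) :
    Fin.cycleRange (deletePoint ρ 0 0) * deletePoint ρ 0 = deletePoint ρ 1 := by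
  have hsucc : ∀ j, (deletePoint ρ 0 j).succ = ρ j.succ := fun j => by
    have := succAbove_deletePoint ρ 0 j
    rwa [h₀, Fin.zero_succAbove, Fin.zero_succAbove] at this
  refine (deletePoint_eq_of_succAbove fun j => ?_).symm
  have h₁ : ρ 1 = (deletePoint ρ 0 0).succ := (hsucc 0).symm
  rw [h₁, Perm.mul_apply, Fin.succAbove_cycleRange]
  induction j using Fin.cases with
  | zero => simp [h₀]
  | succ j =>
    rw [swap_apply_of_ne_of_ne (Fin.succ_ne_zero _), hsucc]
    · rw [Fin.one_succAbove_succ]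
    · exact fun h => by simpa using (deletePoint ρ 0).injective (Fin.succ_injective _ h)

theorem apply_one_of_mem_compSubgroup {n : ℕ} {G : Subgroup (Perm (Fin (n + 1)))}
    (hζ : finRotate (n + 1) ∈ G) (hS : G ≠ ⊤) (hA : G ≠ alternatingGroup (Fin (n + 1)))
    {ρ : Perm (Fin (n + 2))} (hρ : ρ ∈ compSubgroup G) (h₀ : ρ 0 = 0) :
    ρ 1 = 1 ∨ ρ 1 = -1 := by
  have hval : ρ 1 = (deletePoint ρ 0 0).succ := by
    have := succAbove_deletePoint ρ 0 0
    rw [h₀, Fin.zero_succAbove, Fin.zero_succAbove] at this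
    exact this.symm
  have hmem : Fin.cycleRange (deletePoint ρ 0 0) ∈ G := by
    rw [← G.mul_mem_cancel_right (hρ 0), cycleRange_mul_deletePoint_zero h₀]
    exact hρ 1
  by_cases hz : deletePoint ρ 0 0 = 0
  · left
    rw [hval, hz]
    rfl
  rcases (Fin.le_last (deletePoint ρ 0 0)).lt_or_eq with hlt | hl
  · exact ((eq_top_or_eq_alternatingGroup_of_cycleRange_mem hζ hz hlt hmem).elim hS hA).elim
  · right
    rw [hval, hl, Fin.succ_last, ← neg_eq_iff_eq_neg.1 (Fin.neg_last (n + 1))]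

/-- A permutation group containing the translations, in which the stabilizer of `0` sends `1` to
`1` or `-1`, consists of dihedral permutations. -/
theorem le_naturalDihedral {n : ℕ} {H : Subgroup (Perm (Fin (n + 1)))}
    (hD : naturalDihedral (n + 1) ≤ H)
    (hH : ∀ ρ ∈ H, ρ 0 = 0 → ρ 1 = 1 ∨ ρ 1 = -1) : H ≤ naturalDihedral (n + 1) := by
  have hadd : ∀ a, Equiv.addRight a ∈ H := fun a => hD (addRight_mem_naturalDihedral a)
  have hadj : ∀ π ∈ H, ∀ x, π (x + 1) = π x + 1 ∨ π (x + 1) = π x - 1 := by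
    intro π hπ x
    have h := hH (Equiv.addRight (-π x) * π * Equiv.addRight x)
      (mul_mem (mul_mem (hadd _) hπ) (hadd _)) (by simp)
    simp only [Perm.mul_apply, Equiv.coe_addRight, add_comm 1 x] at h
    refine h.imp (fun h => ?_) fun h => ?_
    · rw [eq_add_of_add_neg_eq h, add_comm (π x)]
    · rw [eq_add_of_add_neg_eq h, sub_eq_add_neg, add_comm (π x)]
  have hfix : ∀ π ∈ H, π 0 = 0 → π 1 = 1 → π = 1 := by
    intro π hπ h₀ h₁
    have hall : ∀ m : ℕ, π (m • 1) = m • 1 ∧ π ((m + 1) • 1) = (m + 1) • 1 := by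
      intro m
      induction m with
      | zero => simp [h₀, h₁]
      | succ m ih =>
        refine ⟨ih.2, ?_⟩
        rcases hadj π hπ ((m + 1) • 1) with h | h
        · rw [succ_nsmul _ (m + 1), h, ih.2]
        · rw [ih.2, succ_nsmul _ m, add_sub_cancel_right] at h
          have heq : m • (1 : Fin (n + 1)) + 1 + 1 = m • 1 :=
            π.injective (h.trans ih.1.symm)
          rw [succ_nsmul, succ_nsmul, heq, ih.1]
    ext1 x
    have h := (hall x).1
    rwa [Fin.nsmul_one_val] at h
  have hzero : ∀ π ∈ H, π 0 = 0 → π ∈ naturalDihedral (n + 1) := by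
    intro π hπ h₀
    rcases hH π hπ h₀ with h | h
    · rw [hfix π hπ h₀ h]
      exact one_mem _
    · have hneg := neg_mem_naturalDihedral n
      have := hfix (Equiv.neg _ * π) (mul_mem (hD hneg) hπ) (by simp [h₀]) (by simp [h])
      rw [eq_inv_of_mul_eq_one_right this]
      exact inv_mem hneg
  intro π hπ
  have h := hzero (Equiv.addRight (-π 0) * π) (mul_mem (hadd _) hπ) (by simp)
  exact ((naturalDihedral (n + 1)).mul_mem_cancel_left (addRight_mem_naturalDihedral _)).1 h

theorem comp_of_dihedral_le {n : ℕ} (hn : 0 < n) (G : Subgroup (Equiv.Perm (Fin n)))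
    (hζ : finRotate n ∈ G) (hD : naturalDihedral n ≤ G)
    (hS : G ≠ ⊤) (hA : G ≠ alternatingGroup (Fin n)) :
    Compn (n + 1) (G : Set (Equiv.Perm (Fin n))) =
      (naturalDihedral (n + 1) : Set (Equiv.Perm (Fin (n + 1)))) := by
  obtain ⟨n, rfl⟩ := Nat.exists_eq_add_one.2 hn
  have hle := naturalDihedral_succ_le_compSubgroup hD
  rw [compn_succ_eq_compSubgroup, le_antisymm (le_naturalDihedral hle fun ρ hρ h₀ =>
    apply_one_of_mem_compSubgroup hζ hS hA hρ h₀) hle]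
end

section
/- Let Π be a nontrivial partition of {1,…,n} with no trivial blocks (i.e., Π has at least two blocks and every block has at least two elements). Then the natural cycle ζ_n belongs to Aut Π if and only if there exist integers k ≥ 2 and ℓ ≥ 2 with kℓ = n such that the blocks of Π are exactly the sets {i + mk : 0 ≤ m < ℓ} for 1 ≤ i ≤ k. -/
/-- `Aut Π`: the set of permutations mapping every block of `P` onto a block of `P`. -/
def AutPartition {n : ℕ} (P : Set (Set (Fin n))) : Set (Equiv.Perm (Fin n)) :=
  {π | ∀ B ∈ P, π '' B ∈ P}

theorem val_finRotate {n : ℕ} (x : Fin n) : (finRotate n x : ℕ) = (x + 1) % n := by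
  cases n with
  | zero => exact x.elim0
  | succ N => rw [finRotate_apply, Fin.val_add, Fin.val_one', Nat.add_mod_mod]

/-- The progression `i, i + k, …, i + (l - 1) * k` is the residue class of `i` in `[0, k * l)`. -/
theorem exists_lt_eq_add_mul_iff_mod_eq {k l i x : ℕ} (hi : i < k) (hx : x < k * l) :
    (∃ m : ℕ, m < l ∧ x = i + m * k) ↔ x % k = i := by
  constructor
  · rintro ⟨m, -, rfl⟩
    rw [Nat.add_mul_mod_self_right, Nat.mod_eq_of_lt hi]
  · rintro rfl
    exact ⟨x / k, Nat.div_lt_of_lt_mul hx, by rw [mul_comm, Nat.mod_add_div]⟩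

/-- A translation-invariant equivalence relation on `ℕ` relating `0` to some `n > 0` is
congruence modulo some `k > 0`. -/
theorem exists_forall_iff_modEq_of_translation_invariant {R : ℕ → ℕ → Prop} (hR : Equivalence R)
    (hadd : ∀ a b, R (a + 1) (b + 1) ↔ R a b) {n : ℕ} (hn : 0 < n) (hRn : R 0 n) :
    ∃ k : ℕ, 0 < k ∧ ∀ a b, R a b ↔ a ≡ b [MOD k] := by
  classical
  have hadd' : ∀ c a b, R (a + c) (b + c) ↔ R a b := by
    intro c a b
    induction c with
    | zero => rfl
    | succ c ih => rw [← add_assoc, ← add_assoc, hadd, ih]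
  have hex : ∃ k, 0 < k ∧ R 0 k := ⟨n, hn, hRn⟩
  obtain ⟨hk, hRk⟩ := Nat.find_spec hex
  have hmin : ∀ m, m < Nat.find hex → R 0 m → m = 0 := fun m hm h ↦ by
    by_contra h0
    exact Nat.find_min hex hm ⟨Nat.pos_of_ne_zero h0, h⟩
  generalize Nat.find hex = k at *
  have hmul : ∀ a m, R a (a + k * m) := by
    intro a m
    induction m with
    | zero => exact hR.refl a
    | succ m ih =>
      refine hR.trans ih ?_
      have := (hadd' (a + k * m) 0 k).2 hRk
      rwa [zero_add, add_comm k, add_assoc, ← Nat.mul_succ] at this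
  have hmod : ∀ a, R (a % k) a := fun a ↦ by
    simpa only [Nat.mod_add_div] using hmul (a % k) (a / k)
  have hle : ∀ i j, i ≤ j → j < k → R i j → i = j := by
    intro i j hij hj h
    have h' : R (0 + i) (j - i + i) := by rwa [zero_add, Nat.sub_add_cancel hij]
    have := hmin (j - i) (by omega) ((hadd' i 0 (j - i)).1 h')
    omega
  refine ⟨k, hk, fun a b ↦ ⟨fun h ↦ ?_, fun h ↦ ?_⟩⟩
  · have h' : R (a % k) (b % k) := hR.trans (hmod a) (hR.trans h (hR.symm (hmod b)))
    rcases le_total (a % k) (b % k) with hab | hab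
    · exact hle _ _ hab (Nat.mod_lt _ hk) h'
    · exact (hle _ _ hab (Nat.mod_lt _ hk) (hR.symm h')).symm
  · have h' : R (b % k) a := h ▸ hmod a
    exact hR.trans (hR.symm h') (hmod b)

/-- A setoid on `Fin n` invariant under the natural cycle is congruence modulo a divisor of `n`. -/
theorem exists_dvd_forall_rel_iff_modEq {n : ℕ} (hn : 0 < n) (r : Setoid (Fin n))
    (hr : ∀ x y, r x y → r (finRotate n x) (finRotate n y)) :
    ∃ k : ℕ, 0 < k ∧ k ∣ n ∧ ∀ x y : Fin n, r x y ↔ (x : ℕ) ≡ y [MOD k] := by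
  let c : ℕ → Fin n := fun a ↦ ⟨a % n, Nat.mod_lt a hn⟩
  have hc : ∀ a, finRotate n (c a) = c (a + 1) := fun a ↦ by
    ext
    rw [val_finRotate]
    exact Nat.mod_add_mod a n 1
  have hcval : ∀ x : Fin n, c x = x := fun x ↦ Fin.ext (Nat.mod_eq_of_lt x.isLt)
  have hcn : ∀ a, c (a + n) = c a := fun a ↦ Fin.ext (Nat.add_mod_right a n)
  have hsucc : ∀ a b, r (c a) (c b) → r (c (a + 1)) (c (b + 1)) := fun a b h ↦ by
    simpa only [hc] using hr _ _ h
  have hadd : ∀ m a b, r (c a) (c b) → r (c (a + m)) (c (b + m)) := by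
    intro m a b h
    induction m with
    | zero => exact h
    | succ m ih => exact hsucc _ _ ih
  have hequiv : Equivalence fun a b ↦ r (c a) (c b) :=
    ⟨fun _ ↦ r.refl' _, fun h ↦ r.symm' h, fun h h' ↦ r.trans' h h'⟩
  have hiff : ∀ a b, r (c (a + 1)) (c (b + 1)) ↔ r (c a) (c b) := fun a b ↦ by
    refine ⟨fun h ↦ ?_, hsucc a b⟩
    have := hadd (n - 1) _ _ h
    rwa [add_assoc, add_assoc, Nat.add_sub_cancel' hn, hcn, hcn] at this
  have h0n : r (c 0) (c n) := by
    have h : c n = c 0 := by simpa only [zero_add] using hcn 0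
    rw [h]
  obtain ⟨k, hk, h⟩ := exists_forall_iff_modEq_of_translation_invariant hequiv hiff hn h0n
  refine ⟨k, hk, (Nat.modEq_zero_iff_dvd.1 ((h 0 n).1 h0n).symm), fun x y ↦ ?_⟩
  rw [← h, hcval, hcval]

/-- For a nontrivial partition `P` of `{1, …, n}` (at least two blocks) with no trivial
(singleton) blocks, the natural cycle belongs to `Aut P` iff the blocks of `P` are exactly
the residue classes modulo `k` for some factorization `n = k * l` with `k, l ≥ 2`
(i.e., `[1, n]` is a union of interwoven `P`-blocks). -/
theorem natCycle_mem_aut_iff_interwoven {n : ℕ} (P : Set (Set (Fin n)))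
    (hP : Setoid.IsPartition P) (hP2 : P.Nontrivial)
    (hPnt : ∀ B ∈ P, Set.Nontrivial B) :
    finRotate n ∈ AutPartition P ↔
      ∃ k l : ℕ, 2 ≤ k ∧ 2 ≤ l ∧ k * l = n ∧
        P = {B | ∃ i : ℕ, i < k ∧ B = {x : Fin n | ∃ m : ℕ, m < l ∧ (x : ℕ) = i + m * k}} := by
  constructor
  · intro h
    obtain ⟨r, rfl⟩ : ∃ r : Setoid (Fin n), r.classes = P :=
      ⟨Setoid.mkClasses P hP.2, Setoid.classes_mkClasses P hP⟩
    have hr : ∀ x y, r x y → r (finRotate n x) (finRotate n y) := by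
      intro x y hxy
      obtain ⟨z, hz⟩ := h _ (Setoid.mem_classes r y)
      have hx : finRotate n x ∈ {w | r w z} := hz ▸ Set.mem_image_of_mem _ hxy
      have hy : finRotate n y ∈ {w | r w z} := hz ▸ Set.mem_image_of_mem _ (r.refl' y)
      exact r.trans' hx (r.symm' hy)
    obtain ⟨B, hB, C, hC, hBC⟩ := hP2
    obtain ⟨u, hu, v, hv, huv⟩ := hPnt B hB
    have hn : 0 < n := u.pos
    obtain ⟨k, hk, ⟨l, rfl⟩, hrk⟩ := exists_dvd_forall_rel_iff_modEq hn r hr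
    have hk1 : k ≠ 1 := by
      rintro rfl
      obtain ⟨b, rfl⟩ := hB
      obtain ⟨c, rfl⟩ := hC
      simp [hrk, Nat.modEq_one] at hBC
    have hl1 : l ≠ 1 := by
      rintro rfl
      obtain ⟨b, rfl⟩ := hB
      have := (hrk u v).1 (r.trans' hu (r.symm' hv))
      exact huv (Fin.ext (this.eq_of_lt_of_lt (by omega) (by omega)))
    have hl : 0 < l := Nat.pos_of_mul_pos_left hn
    refine ⟨k, l, by omega, by omega, rfl, Set.ext fun D ↦ ⟨?_, ?_⟩⟩
    · rintro ⟨y, rfl⟩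
      refine ⟨y % k, Nat.mod_lt _ hk, Set.ext fun x ↦ ?_⟩
      exact (hrk x y).trans (exists_lt_eq_add_mul_iff_mod_eq (Nat.mod_lt _ hk) x.isLt).symm
    · rintro ⟨i, hi, rfl⟩
      refine ⟨⟨i, hi.trans_le (Nat.le_mul_of_pos_right k hl)⟩, Set.ext fun x ↦ ?_⟩
      refine (exists_lt_eq_add_mul_iff_mod_eq hi x.isLt).trans ?_
      rw [Set.mem_ofPred_eq, hrk, Nat.ModEq, Nat.mod_eq_of_lt hi]
  · rintro ⟨k, l, hk, -, rfl, rfl⟩ B ⟨i, hi, rfl⟩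
    have hi' : (i + 1) % k < k := Nat.mod_lt _ (by omega)
    refine ⟨(i + 1) % k, hi', Set.ext fun y ↦ ?_⟩
    obtain ⟨x, rfl⟩ := (finRotate (k * l)).surjective y
    rw [(finRotate (k * l)).injective.mem_set_image]
    refine (exists_lt_eq_add_mul_iff_mod_eq hi x.isLt).trans
      (Iff.trans ?_ (exists_lt_eq_add_mul_iff_mod_eq hi' (Fin.isLt _)).symm)
    rw [val_finRotate, Nat.mod_mod_of_dvd _ (Nat.dvd_mul_right k l)]
    rw [← Nat.ModEq, (Nat.ModEq.refl 1).add_iff_right, Nat.ModEq, Nat.mod_eq_of_lt hi]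
end
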